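/- arXiv:1311.5693 — 2 statements merged into one kernel-verified Lean document; each statement's English description precedes it below -/
import Mathlib

section
/- Let E be a real inner product space, let A : [0,∞) → [0,∞) be a function, and suppose the map t ↦ t·A(t²) is nondecreasing on [0,∞). Then for all vectors X, Y ∈ E one has ⟨A(‖Y‖²)Y − A(‖X‖²)X, Y − X⟩ ≥ (‖Y‖·A(‖Y‖²) − ‖X‖·A(‖X‖²))·(‖Y‖ − ‖X‖) ≥ 0. -/
open scoped RealInnerProductSpace

/-- If `A : [0,∞) → [0,∞)` is such that `t ↦ t·A(t²)` is nondecreasing on `[0,∞)`,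
then for all vectors `X, Y` in a real inner product space,
`⟨A(‖Y‖²)Y − A(‖X‖²)X, Y − X⟩ ≥ (‖Y‖·A(‖Y‖²) − ‖X‖·A(‖X‖²))·(‖Y‖ − ‖X‖) ≥ 0`. -/
theorem inner_monotone_vector_field
    {E : Type*} [NormedAddCommGroup E] [InnerProductSpace ℝ E]
    (A : ℝ → ℝ) (hA : ∀ t ≥ 0, 0 ≤ A t)
    (hmono : MonotoneOn (fun t => t * A (t ^ 2)) (Set.Ici (0 : ℝ)))
    (X Y : E) :
    (‖Y‖ * A (‖Y‖ ^ 2) - ‖X‖ * A (‖X‖ ^ 2)) * (‖Y‖ - ‖X‖) ≤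
      ⟪A (‖Y‖ ^ 2) • Y - A (‖X‖ ^ 2) • X, Y - X⟫ ∧
    0 ≤ (‖Y‖ * A (‖Y‖ ^ 2) - ‖X‖ * A (‖X‖ ^ 2)) * (‖Y‖ - ‖X‖) := by
  constructor
  · have hgap : 0 ≤ (A (‖X‖ ^ 2) + A (‖Y‖ ^ 2)) * (‖X‖ * ‖Y‖ - ⟪X, Y⟫) :=
      mul_nonneg (add_nonneg (hA _ (sq_nonneg _)) (hA _ (sq_nonneg _)))
        (sub_nonneg.2 (real_inner_le_norm X Y))
    simp only [inner_sub_left, inner_sub_right, real_inner_smul_left,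
      real_inner_self_eq_norm_sq, real_inner_comm X Y]
    linarith
  · rcases le_total ‖X‖ ‖Y‖ with h | h
    · exact mul_nonneg (sub_nonneg.2 (hmono (norm_nonneg X) (norm_nonneg Y) h))
        (sub_nonneg.2 h)
    · exact mul_nonneg_of_nonpos_of_nonpos
        (sub_nonpos.2 (hmono (norm_nonneg Y) (norm_nonneg X) h)) (sub_nonpos.2 h)
end

section
/- Let E be a real inner product space and A : [0,∞) → [0,∞) a function with A(s) > 0 for all s > 0 and such that t ↦ t·A(t²) is strictly increasing on [0,∞). If X, Y ∈ E satisfy ⟨A(‖Y‖²)Y − A(‖X‖²)X, Y − X⟩ = 0, then X = Y. -/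
open scoped RealInnerProductSpace

/-- Strict monotonicity (equality case) of the vector field `V ↦ A(‖V‖²)V`:
if `A` is positive on `(0,∞)`, `t ↦ t·A(t²)` is strictly increasing on `[0,∞)`
and `⟨A(‖Y‖²)Y − A(‖X‖²)X, Y − X⟩ = 0`, then `X = Y`. -/
theorem eq_of_inner_monotone_vector_field_eq_zero
    {E : Type*} [NormedAddCommGroup E] [InnerProductSpace ℝ E]
    (A : ℝ → ℝ) (hApos : ∀ s > 0, 0 < A s)
    (hmono : StrictMonoOn (fun t => t * A (t ^ 2)) (Set.Ici (0 : ℝ)))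
    (X Y : E)
    (h : ⟪A (‖Y‖ ^ 2) • Y - A (‖X‖ ^ 2) • X, Y - X⟫ = 0) :
    X = Y := by
  rcases eq_or_ne X 0 with rfl | hX
  · by_contra hY
    have hy : 0 < ‖Y‖ := norm_pos_iff.2 (Ne.symm hY)
    simp only [smul_zero, sub_zero, real_inner_smul_left, real_inner_self_eq_norm_sq] at h
    have := mul_pos (hApos (‖Y‖ ^ 2) (by positivity)) (pow_pos hy 2)
    linarith
  rcases eq_or_ne Y 0 with rfl | hY
  · have hx : 0 < ‖X‖ := norm_pos_iff.2 hX
    simp only [smul_zero, zero_sub, inner_neg_neg, real_inner_smul_left,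
      real_inner_self_eq_norm_sq] at h
    have := mul_pos (hApos (‖X‖ ^ 2) (by positivity)) (pow_pos hx 2)
    linarith
  have hx : 0 < ‖X‖ := norm_pos_iff.2 hX
  have hy : 0 < ‖Y‖ := norm_pos_iff.2 hY
  have ha := hApos (‖X‖ ^ 2) (by positivity)
  have hb := hApos (‖Y‖ ^ 2) (by positivity)
  have hcs := mul_nonneg (add_pos ha hb).le (sub_nonneg.2 (real_inner_le_norm X Y))
  simp only [inner_sub_left, inner_sub_right, real_inner_smul_left,
    real_inner_self_eq_norm_sq, real_inner_comm X Y] at h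
  have hnorm : ‖X‖ = ‖Y‖ := by
    rcases lt_trichotomy ‖X‖ ‖Y‖ with hlt | heq | hgt
    · have hA := hmono hx.le hy.le hlt
      have := mul_pos (sub_pos.2 hA) (sub_pos.2 hlt)
      linarith
    · exact heq
    · have hA := hmono hy.le hx.le hgt
      have := mul_pos (sub_pos.2 hA) (sub_pos.2 hgt)
      linarith
  rw [hnorm] at h
  have hinner : ‖Y‖ ^ 2 - ⟪X, Y⟫ = 0 := by
    refine (mul_eq_zero.1 (?_ : A (‖Y‖ ^ 2) * (‖Y‖ ^ 2 - ⟪X, Y⟫) = 0)).resolve_left hb.ne'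
    linarith [real_inner_comm X Y]
  have hsq : ‖X - Y‖ ^ 2 = 0 := by
    rw [norm_sub_sq_real, hnorm]
    linarith
  exact sub_eq_zero.1 (norm_eq_zero.1 (pow_eq_zero_iff two_ne_zero |>.1 hsq))
end
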